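/- arXiv:2210.06834 — 2 statements merged into one kernel-verified Lean document; each statement's English description precedes it below -/
import Mathlib

section
/- For every real z with 0 < |z| < π, ∫₀^∞ [cosh(πθ/2)(cosh(zθ) - 1)] / [sinh(πθ) sinh(πθ/2)] dθ = 1/π - (z/π)·cot(z), where cot(z) = cos(z)/sin(z). -/
open Real MeasureTheory Set

lemma cot_hasSum (z : ℝ) (hz0 : 0 < |z|) (hz : |z| < π) :
    HasSum (fun n : ℕ => 1 / (z / π - ((n : ℝ) + 1)) + 1 / (z / π + ((n : ℝ) + 1)))
      (π * (Real.cos z / Real.sin z) - 1 / (z / π)) := by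
  have hpi := Real.pi_pos
  have hx : ((z / π : ℝ) : ℂ) ∈ Complex.integerComplement := by
    rintro ⟨k, hk⟩
    have hk' : (k : ℝ) = z / π := by exact_mod_cast hk
    have h1 : |(k : ℝ)| < 1 := by
      rw [hk', abs_div, abs_of_pos hpi, div_lt_one hpi]; exact hz
    have h2 : |k| < 1 := by exact_mod_cast h1
    have h3 : k = 0 := Int.abs_lt_one_iff.mp h2
    rw [h3] at hk'
    have : z = 0 := by
      have := hk'.symm
      field_simp at this
      simpa using this
    simp [this] at hz0
  have hs := (summable_cotTerm hx).hasSum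
  have ht := cot_series_rep' hx
  have hs' : HasSum (fun n : ℕ => 1 / (((z / π : ℝ) : ℂ) - (n + 1)) + 1 / (((z / π : ℝ) : ℂ) + (n + 1)))
    (π * Complex.cot (π * ((z / π : ℝ) : ℂ)) - 1 / ((z / π : ℝ) : ℂ)) := by
    rw [ht]; exact hs
  have e : (π : ℂ) * ((z / π : ℝ) : ℂ) = (z : ℂ) := by
    rw [← Complex.ofReal_mul]; congr 1; field_simp
  rw [e, Complex.cot] at hs'
  rw [← Complex.hasSum_ofReal]
  push_cast at hs' ⊢
  exact hs'

lemma int_term (z : ℝ) (hz : |z| < π) (n : ℕ) :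
    IntegrableOn (fun θ : ℝ => 2 * (((n + 1 : ℕ) : ℝ) * Real.exp (-(π * θ)) ^ (n + 1)) *
        (Real.cosh (z * θ) - 1)) (Ioi 0) ∧
    ∫ θ in Ioi (0 : ℝ), 2 * (((n + 1 : ℕ) : ℝ) * Real.exp (-(π * θ)) ^ (n + 1)) *
        (Real.cosh (z * θ) - 1) =
      -(z / π ^ 2) * (1 / (z / π - ((n : ℝ) + 1)) + 1 / (z / π + ((n : ℝ) + 1))) := by
  have hpi := Real.pi_pos
  obtain ⟨hl, hr⟩ := abs_lt.mp hz
  set m : ℝ := (n : ℝ) + 1 with hm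
  have hm1 : 1 ≤ m := by simp [hm]
  have hmpi : π ≤ m * π := by nlinarith
  have ha : -(m * π) + z < 0 := by linarith
  have hb : -(m * π) - z < 0 := by linarith
  have hc : -(m * π) < 0 := by linarith
  have ia := integrableOn_exp_mul_Ioi ha 0
  have ib := integrableOn_exp_mul_Ioi hb 0
  have ic := integrableOn_exp_mul_Ioi hc 0
  have heq : (fun θ : ℝ => 2 * (((n + 1 : ℕ) : ℝ) * Real.exp (-(π * θ)) ^ (n + 1)) *
        (Real.cosh (z * θ) - 1)) = fun θ => m * (Real.exp ((-(m * π) + z) * θ)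
          + Real.exp ((-(m * π) - z) * θ) - 2 * Real.exp (-(m * π) * θ)) := by
    funext θ
    rw [← Real.exp_nat_mul, Real.cosh_eq]
    have e1 : (-(m * π) + z) * θ = ((n + 1 : ℕ) : ℝ) * -(π * θ) + z * θ := by
      rw [hm]; push_cast; ring
    have e2 : (-(m * π) - z) * θ = ((n + 1 : ℕ) : ℝ) * -(π * θ) + -(z * θ) := by
      rw [hm]; push_cast; ring
    have e3 : -(m * π) * θ = ((n + 1 : ℕ) : ℝ) * -(π * θ) := by
      rw [hm]; push_cast; ring
    rw [e1, e2, e3, Real.exp_add, Real.exp_add]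
    have : ((n + 1 : ℕ) : ℝ) = m := by rw [hm]; push_cast; rfl
    rw [this]; ring
  have iab : IntegrableOn (fun θ => Real.exp ((-(m * π) + z) * θ)
          + Real.exp ((-(m * π) - z) * θ)) (Ioi 0) := ia.add ib
  constructor
  · rw [heq]
    exact ((ia.add ib).sub (ic.const_mul 2)).const_mul m
  · rw [heq, integral_const_mul, integral_sub iab (ic.const_mul 2), integral_const_mul]
    have := integral_add ia ib
    rw [this, integral_exp_mul_Ioi ha, integral_exp_mul_Ioi hb, integral_exp_mul_Ioi hc]
    simp only [mul_zero, Real.exp_zero]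
    have h1 : z / π - m = (-(m * π) + z) / π := by field_simp; ring
    have h2 : z / π + m = -(-(m * π) - z) / π := by field_simp; ring
    rw [h1, h2]
    have a0 := ha.ne
    have b0 := hb.ne
    have m0 : m ≠ 0 := by linarith
    have hA : -(m * π) + z ≠ 0 := a0
    generalize hA' : -(m * π) + z = A at *
    generalize hB' : -(m * π) - z = B at *
    have hz2 : z = (A - B) / 2 := by linarith
    have hm2 : m = -(A + B) / (2 * π) := by field_simp; linarith
    have hAB : A + B ≠ 0 := by linarith
    rw [hz2, hm2]
    field_simp
    ring

theorem stmt1 (z : ℝ) (hz0 : 0 < |z|) (hz : |z| < π) :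
    ∫ θ in Set.Ioi (0:ℝ),
        Real.cosh (π * θ / 2) * (Real.cosh (z * θ) - 1) /
          (Real.sinh (π * θ) * Real.sinh (π * θ / 2))
      = 1 / π - (z / π) * (Real.cos z / Real.sin z) := by
  have hpi := Real.pi_pos
  have hzne : z ≠ 0 := by simpa using hz0
  have hcot := (cot_hasSum z hz0 hz).mul_left (-(z / π ^ 2))
  let F : ℕ → ℝ → ℝ := fun n θ => 2 * (((n + 1 : ℕ) : ℝ) * Real.exp (-(π * θ)) ^ (n + 1)) *
        (Real.cosh (z * θ) - 1)
  have hnorm : ∀ n θ, ‖F n θ‖ = F n θ := by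
    intro n θ
    apply Real.norm_of_nonneg
    have := Real.one_le_cosh (z * θ)
    have h2 : 0 ≤ Real.cosh (z * θ) - 1 := by linarith
    positivity
  have hs := hasSum_integral_of_summable_integral_norm (F := F)
    (μ := volume.restrict (Ioi (0 : ℝ))) (fun n => (int_term z hz n).1) (by
      simp_rw [hnorm]
      refine hcot.summable.congr fun n => ?_
      exact (int_term z hz n).2.symm)
  have hs2 := hcot.unique (hs.congr_fun fun n => ((int_term z hz n).2).symm)
  have hval : -(z / π ^ 2) * (π * (Real.cos z / Real.sin z) - 1 / (z / π)) =
      1 / π - (z / π) * (Real.cos z / Real.sin z) := by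
    generalize Real.cos z / Real.sin z = c
    field_simp
    ring
  rw [← hval, hs2]
  refine setIntegral_congr_fun measurableSet_Ioi fun θ hθ => ?_
  have hθ' : 0 < θ := hθ
  set x := Real.exp (-(π * θ)) with hx
  have hx0 : 0 < x := Real.exp_pos _
  have hx1 : x < 1 := by rw [hx, Real.exp_lt_one_iff]; nlinarith [mul_pos hpi hθ']
  have hg : HasSum (fun n : ℕ => (n : ℝ) * x ^ n) (x / (1 - x) ^ 2) :=
    hasSum_coe_mul_geometric_of_norm_lt_one (by rwa [Real.norm_of_nonneg hx0.le])
  have hg1 := (hasSum_nat_add_iff' 1).mpr hg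
  simp only [Finset.sum_range_one, Nat.cast_zero, zero_mul, sub_zero] at hg1
  have hg2 := ((hg1.mul_left 2).mul_right (Real.cosh (z * θ) - 1)).tsum_eq
  simp only [F]
  rw [hg2]
  generalize Real.cosh (z * θ) - 1 = C
  have hsh : 0 < Real.sinh (π * θ / 2) := Real.sinh_pos_iff.mpr (by positivity)
  have hch : 0 < Real.cosh (π * θ / 2) := Real.cosh_pos _
  have e1 : Real.sinh (π * θ) = 2 * Real.sinh (π * θ / 2) * Real.cosh (π * θ / 2) := by
    rw [← Real.sinh_two_mul]; congr 1; ring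
  have e2 : (1 - x) ^ 2 = 4 * x * Real.sinh (π * θ / 2) ^ 2 := by
    have h1 : x = Real.exp (-(π * θ / 2)) ^ 2 := by
      rw [hx, ← Real.exp_nat_mul]; congr 1; push_cast; ring
    have h2 : Real.exp (π * θ / 2) * Real.exp (-(π * θ / 2)) = 1 := by
      rw [← Real.exp_add]; simp
    rw [Real.sinh_eq, h1]
    generalize Real.exp (π * θ / 2) = p at *
    generalize Real.exp (-(π * θ / 2)) = q at *
    have : (4 * q ^ 2 * ((p - q) / 2) ^ 2) = (p * q - q ^ 2) ^ 2 := by ring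
    rw [this, h2]
  rw [e1, e2]
  field_simp
  try ring
end

section
/- For γ ∈ (0,π), b(γ, π - γ) = (1/2) a(2γ), where b(γ,β) := ∫₀^∞ [cosh(πθ/2) cosh((γ-β)θ) - cosh((π/2 - γ - β)θ)] / [2 sinh((γ+β)θ) sinh(πθ/2)] dθ and a(γ) := 1/π + (1 - γ/π) cot(γ) for γ ≠ π, with a(π) := 0. -/
open Real MeasureTheory Set

noncomputable def bFun (γ β : ℝ) : ℝ :=
  ∫ θ in Set.Ioi (0:ℝ),
    (Real.cosh (π * θ / 2) * Real.cosh ((γ - β) * θ) - Real.cosh ((π / 2 - γ - β) * θ)) /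
      (2 * Real.sinh ((γ + β) * θ) * Real.sinh (π * θ / 2))

noncomputable def aFun (γ : ℝ) : ℝ :=
  if γ = π then 0 else 1 / π + (1 - γ / π) * (Real.cos γ / Real.sin γ)

lemma cot_aux (c : ℝ) (h1 : -π < c) (h2 : c < π) (h0 : c ≠ 0) :
    HasSum (fun n : ℕ => c ^ 2 / (π * (((n:ℝ) + 1) ^ 2 * π ^ 2 - c ^ 2)))
      (1 / (2 * π) - c / (2 * π) * (Real.cos c / Real.sin c)) := by
  have hpi := Real.pi_pos
  have hx1 : -1 < c / π := by rw [lt_div_iff₀ hpi]; linarith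
  have hx2 : c / π < 1 := by rw [div_lt_iff₀ hpi]; linarith
  have hx0 : c / π ≠ 0 := by positivity
  obtain ⟨x, hxc⟩ : ∃ x, x = c / π := ⟨_, rfl⟩
  rw [← hxc] at hx1 hx2 hx0
  have hc : c = π * x := by rw [hxc]; field_simp
  have hmem : (x : ℂ) ∈ Complex.integerComplement := by
    rw [Complex.mem_integerComplement_iff]
    rintro ⟨n, hn⟩
    have hn' : (n : ℝ) = x := by exact_mod_cast hn
    rw [← hn'] at hx1 hx2 hx0
    have a1 : -1 < n := by exact_mod_cast hx1
    have a2 : n < 1 := by exact_mod_cast hx2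
    have a3 : n ≠ 0 := by exact_mod_cast hx0
    omega
  have hs := (summable_cotTerm hmem).hasSum
  have ht : ∑' n, cotTerm (x:ℂ) n = π * Complex.cot (π * x) - 1 / x := by
    rw [cot_series_rep' hmem]
  rw [ht] at hs
  have hs2 := hs.mul_left (-(x:ℂ) / (2 * π))
  rw [← Complex.hasSum_ofReal]
  convert! hs2 using 1
  · funext n
    have hd1 : x - (n + 1) ≠ 0 := by
      have : (0:ℝ) ≤ n := n.cast_nonneg
      linarith
    have hd2 : x + (n + 1) ≠ 0 := by
      have : (0:ℝ) ≤ n := n.cast_nonneg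
      linarith
    have key : c ^ 2 / (π * (((n:ℝ) + 1) ^ 2 * π ^ 2 - c ^ 2))
        = -x / (2 * π) * (1 / (x - (n + 1)) + 1 / (x + (n + 1))) := by
      have e : ((n:ℝ) + 1) ^ 2 * π ^ 2 - c ^ 2 = - π ^ 2 * ((x - (n + 1)) * (x + (n + 1))) := by
        rw [hc]; ring
      rw [e, hc]
      field_simp
      ring
    rw [key, cotTerm]
    push_cast
    ring
  · have key : 1 / (2 * π) - c / (2 * π) * (Real.cos c / Real.sin c)
        = -x / (2 * π) * (π * (Real.cos (π * x) / Real.sin (π * x)) - 1 / x) := by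
      rw [← hc]
      generalize Real.cos c / Real.sin c = t
      rw [hxc]; field_simp; ring
    rw [key, Complex.cot]
    push_cast
    ring

lemma sinh_aux (θ : ℝ) (h : 0 < θ) :
    HasSum (fun n : ℕ => ((n:ℝ) + 1) * Real.exp (-(((n:ℝ) + 1) * π) * θ))
      (1 / (4 * Real.sinh (π * θ / 2) ^ 2)) := by
  have hpt : 0 < π * θ := by positivity
  have hr : ‖Real.exp (-(π * θ))‖ < 1 := by
    rw [Real.norm_eq_abs, abs_of_pos (Real.exp_pos _), Real.exp_lt_one_iff]; linarith
  have hs := hasSum_coe_mul_geometric_of_norm_lt_one hr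
  rw [← hasSum_nat_add_iff' 1] at hs
  convert! hs using 1
  · funext n
    rw [← Real.exp_nat_mul]
    push_cast
    congr 2
    ring
  · simp only [Finset.range_one, Finset.sum_singleton, Nat.cast_zero, zero_mul, sub_zero]
    rw [Real.sinh_eq]
    have e1 : Real.exp (-(π * θ)) = Real.exp (-(π * θ / 2)) ^ 2 := by
      rw [← Real.exp_nat_mul]; congr 1; push_cast; ring
    have e2 : Real.exp (π * θ / 2) * Real.exp (-(π * θ / 2)) = 1 := by
      rw [← Real.exp_add]; simp
    have hlt : Real.exp (-(π * θ / 2)) < Real.exp (π * θ / 2) := by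
      apply Real.exp_lt_exp.2; linarith
    rw [e1]
    generalize Real.exp (π * θ / 2) = a at *
    have hp := Real.exp_pos (-(π * θ / 2))
    generalize Real.exp (-(π * θ / 2)) = b at *
    have h3 : 1 - b ^ 2 = b * (a - b) := by rw [← e2]; ring
    have h4 : a - b ≠ 0 := by linarith
    rw [h3]
    field_simp
    ring

theorem stmt4 (γ : ℝ) (hγ : 0 < γ) (hγπ : γ < π) :
    bFun γ (π - γ) = (1 / 2) * aFun (2 * γ) := by
  have hpi := Real.pi_pos
  obtain ⟨c, hc⟩ : ∃ c, c = 2 * γ - π := ⟨_, rfl⟩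
  have h1 : -π < c := by linarith
  have h2 : c < π := by linarith
  have hb : bFun γ (π - γ) = ∫ θ in Set.Ioi (0:ℝ),
      (Real.cosh (c * θ) - 1) * (1 / (4 * Real.sinh (π * θ / 2) ^ 2)) := by
    unfold bFun
    refine setIntegral_congr_fun measurableSet_Ioi fun θ hθ => ?_
    have hθ : 0 < θ := hθ
    have hsh : Real.sinh (π * θ / 2) ≠ 0 := (Real.sinh_pos_iff.2 (by positivity)).ne'
    have hch : Real.cosh (π * θ / 2) ≠ 0 := (Real.cosh_pos _).ne'
    have e1 : Real.cosh ((π / 2 - γ - (π - γ)) * θ) = Real.cosh (π * θ / 2) := by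
      rw [← Real.cosh_neg]; congr 1; ring
    have e2 : Real.sinh ((γ + (π - γ)) * θ)
        = 2 * Real.sinh (π * θ / 2) * Real.cosh (π * θ / 2) := by
      rw [← Real.sinh_two_mul]; congr 1; ring
    have e3 : (γ - (π - γ)) * θ = c * θ := by rw [hc]; ring
    simp only [e1, e2, e3]
    field_simp
    ring
  rw [hb]
  by_cases h0 : c = 0
  · have : 2 * γ = π := by linarith
    simp [h0, aFun, this]
  have hne : 2 * γ ≠ π := fun h => h0 (by linarith)
  have hdec : ∀ (n : ℕ) (θ : ℝ),
      (Real.cosh (c * θ) - 1) * (((n:ℝ) + 1) * Real.exp (-(((n:ℝ) + 1) * π) * θ))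
      = ((n:ℝ) + 1) * (1 / 2 * Real.exp ((c - (n + 1) * π) * θ)
        + 1 / 2 * Real.exp ((-c - (n + 1) * π) * θ) - Real.exp (-(((n:ℝ) + 1) * π) * θ)) := by
    intro n θ
    have a1 : Real.exp ((c - (n + 1) * π) * θ)
        = Real.exp (c * θ) * Real.exp (-(((n:ℝ) + 1) * π) * θ) := by
      rw [← Real.exp_add]; congr 1; ring
    have a2 : Real.exp ((-c - (n + 1) * π) * θ)
        = Real.exp (-(c * θ)) * Real.exp (-(((n:ℝ) + 1) * π) * θ) := by
      rw [← Real.exp_add]; congr 1; ring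
    rw [a1, a2, Real.cosh_eq]; ring
  have hNp : ∀ n : ℕ, π ≤ ((n:ℝ) + 1) * π := fun n => by
    have : (0:ℝ) ≤ n := n.cast_nonneg
    nlinarith
  have l1 : ∀ n : ℕ, c - ((n:ℝ) + 1) * π < 0 := fun n => by linarith [hNp n]
  have l2 : ∀ n : ℕ, -c - ((n:ℝ) + 1) * π < 0 := fun n => by linarith [hNp n]
  have l3 : ∀ n : ℕ, -(((n:ℝ) + 1) * π) < 0 := fun n => by linarith [hNp n]
  have i1 := fun n => (integrableOn_exp_mul_Ioi (l1 n) 0).const_mul (1 / 2)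
  have i2 := fun n => (integrableOn_exp_mul_Ioi (l2 n) 0).const_mul (1 / 2)
  have i3 := fun n => (integrableOn_exp_mul_Ioi (l3 n) 0)
  have hint : ∀ n : ℕ, Integrable (fun θ : ℝ => (Real.cosh (c * θ) - 1) *
      (((n:ℝ) + 1) * Real.exp (-(((n:ℝ) + 1) * π) * θ))) (volume.restrict (Ioi 0)) := by
    intro n
    simp only [hdec]
    exact (((i1 n).add (i2 n)).sub (i3 n)).const_mul _
  have hval : ∀ n : ℕ, ∫ θ in Ioi (0:ℝ), (Real.cosh (c * θ) - 1) *
      (((n:ℝ) + 1) * Real.exp (-(((n:ℝ) + 1) * π) * θ))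
      = c ^ 2 / (π * (((n:ℝ) + 1) ^ 2 * π ^ 2 - c ^ 2)) := by
    intro n
    simp only [hdec]
    rw [integral_const_mul, integral_sub (by exact (i1 n).add (i2 n)) (i3 n),
      integral_add (i1 n) (i2 n), integral_const_mul, integral_const_mul,
      integral_exp_mul_Ioi (l1 n), integral_exp_mul_Ioi (l2 n), integral_exp_mul_Ioi (l3 n)]
    simp only [mul_zero, Real.exp_zero]
    have k1 := (l1 n).ne
    have k2 := (l2 n).ne
    have k3 : (n:ℝ) + 1 ≠ 0 := by positivity
    have e : ((n:ℝ) + 1) ^ 2 * π ^ 2 - c ^ 2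
        = (c - ((n:ℝ) + 1) * π) * (-c - ((n:ℝ) + 1) * π) := by ring
    rw [e]
    generalize (n:ℝ) + 1 = N at *
    field_simp
    ring
  have hcot := cot_aux c h1 h2 h0
  have hsum := hasSum_integral_of_summable_integral_norm hint (by
    refine hcot.summable.congr fun n => ?_
    rw [← hval n]
    refine integral_congr_ae (Filter.Eventually.of_forall fun θ => ?_)
    have : 0 ≤ Real.cosh (c * θ) - 1 := by linarith [Real.one_le_cosh (c * θ)]
    simp only
    rw [Real.norm_eq_abs, abs_of_nonneg (by positivity)])
  simp only [hval] at hsum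
  have heq := hsum.unique hcot
  have hI : ∫ θ in Ioi (0:ℝ), (Real.cosh (c * θ) - 1) * (1 / (4 * Real.sinh (π * θ / 2) ^ 2))
      = ∫ θ in Ioi (0:ℝ), ∑' n : ℕ, (Real.cosh (c * θ) - 1) *
      (((n:ℝ) + 1) * Real.exp (-(((n:ℝ) + 1) * π) * θ)) := by
    refine setIntegral_congr_fun measurableSet_Ioi fun θ hθ => ?_
    exact ((sinh_aux θ hθ).mul_left _).tsum_eq.symm
  rw [hI, heq, aFun, if_neg hne]
  have t : 2 * γ = c + π := by linarith
  rw [t, Real.cos_add_pi, Real.sin_add_pi, neg_div_neg_eq]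
  generalize Real.cos c / Real.sin c = t
  field_simp
  ring
end
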